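/- In the iterative construction T_0, ..., T_n, T_{n+1} = T_n^{μ_p} starting from a finite p-cyclically monotone operator with domain {x_1,...,x_n} in a finite-dimensional Hilbert space, the domain of T_{n+1} is a closed set. -/

import Mathlib

open scoped BigOperators RealInnerProductSpace

/-- The cyclic sum `∑_{i=0}^{p} ⟨x_{i+1} - x_i, x_i*⟩` (indices mod `p+1`),
in a real Hilbert space identified with its dual. -/
def cycSumH {X : Type*} [NormedAddCommGroup X] [InnerProductSpace ℝ X] (p : ℕ)
    (z : Fin (p + 1) → X × X) : ℝ :=
  ∑ i, ⟪(z (i + 1)).1 - (z i).1, (z i).2⟫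

/-- `T` (identified with its graph) is `p`-cyclically monotone. -/
def CycMonoH {X : Type*} [NormedAddCommGroup X] [InnerProductSpace ℝ X] (p : ℕ)
    (T : Set (X × X)) : Prop :=
  ∀ z : Fin (p + 1) → X × X, (∀ i, z i ∈ T) → cycSumH p z ≤ 0

/-- The `p`-cyclically monotone polar of `T`. -/
def cycPolarH {X : Type*} [NormedAddCommGroup X] [InnerProductSpace ℝ X] (p : ℕ)
    (T : Set (X × X)) : Set (X × X) :=
  {w | ∀ z : Fin (p + 1) → X × X,
    z 0 = w → (∀ i, i ≠ 0 → z i ∈ T) → cycSumH p z ≤ 0}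

/-- Domain of a multivalued operator (graph). -/
def opDom {X Y : Type*} (T : Set (X × Y)) : Set X := {x | ∃ y, (x, y) ∈ T}

/-- Range of a multivalued operator (graph). -/
def opRan {X Y : Type*} (T : Set (X × Y)) : Set Y := {y | ∃ x, (x, y) ∈ T}

/-- Image of a multivalued operator (graph) at a point. -/
def opIm {X Y : Type*} (T : Set (X × Y)) (x : X) : Set Y := {y | (x, y) ∈ T}

/-- Conic Carathéodory theorem: a conic combination can be rewritten with linearly independent
generators. -/
theorem exists_nonneg_linearIndepOn {ι E : Type*} [Fintype ι] [AddCommGroup E] [Module ℝ E]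
    (g : ι → E) (t : ι → ℝ) (ht : ∀ i, 0 ≤ t i) :
    ∃ s : ι → ℝ, (∀ i, 0 ≤ s i) ∧ ∑ i, s i • g i = ∑ i, t i • g i ∧
      LinearIndepOn ℝ g {i | s i ≠ 0} := by
  classical
  induction hm : (Finset.univ.filter fun i => t i ≠ 0).card using Nat.strong_induction_on
    generalizing t with
  | _ m ih =>
  by_cases hli : LinearIndepOn ℝ g {i | t i ≠ 0}
  · exact ⟨t, ht, rfl, hli⟩
  obtain ⟨c, hcg, hcs, k, hck⟩ : ∃ c : ι → ℝ, ∑ i, c i • g i = 0 ∧ (∀ i, t i = 0 → c i = 0) ∧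
      ∃ k, 0 < c k := by
    have : ({i | t i ≠ 0} : Set ι) = ↑(Finset.univ.filter fun i => t i ≠ 0) := by
      ext; simp
    rw [this, linearIndepOn_finset_iff] at hli
    push Not at hli
    obtain ⟨f, hf, k, hk, hfk⟩ := hli
    have key : ∑ i, (if t i = 0 then 0 else f i) • g i = 0 := by
      rw [← hf, Finset.sum_filter]
      refine Finset.sum_congr rfl fun i _ => ?_
      by_cases h : t i = 0 <;> simp [h]
    have hk' : t k ≠ 0 := by simpa using hk
    rcases lt_or_gt_of_ne hfk with h | h
    · refine ⟨fun i => -(if t i = 0 then 0 else f i), ?_, fun i hi => by simp [hi], k, ?_⟩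
      · simp only [neg_smul, Finset.sum_neg_distrib, key, neg_zero]
      · simpa [hk'] using h
    · exact ⟨fun i => if t i = 0 then 0 else f i, key, fun i hi => by simp [hi], k,
        by simpa [hk'] using h⟩
  obtain ⟨j, hj, hmin⟩ := Finset.exists_min_image (Finset.univ.filter fun i => 0 < c i)
    (fun i => t i / c i) ⟨k, by simpa using hck⟩
  simp only [Finset.mem_filter, Finset.mem_univ, true_and] at hj hmin
  have hθ : 0 ≤ t j / c j := div_nonneg (ht j) hj.le
  have hnn : ∀ i, 0 ≤ t i - t j / c j * c i := by
    intro i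
    rcases le_or_gt (c i) 0 with h | h
    · nlinarith [ht i]
    · have := (le_div_iff₀ h).1 (hmin i h)
      linarith
  have hlt : (Finset.univ.filter fun i => t i - t j / c j * c i ≠ 0).card < m := by
    rw [← hm]
    refine Finset.card_lt_card (Finset.ssubset_iff_of_subset ?_ |>.2 ⟨j, ?_, ?_⟩)
    · intro i
      simp only [Finset.mem_filter, Finset.mem_univ, true_and]
      intro h h0
      exact h (by simp [h0, hcs i h0])
    · simp only [Finset.mem_filter, Finset.mem_univ, true_and]
      intro h0
      exact hj.ne' (hcs j h0)
    · simp [hj.ne']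
  obtain ⟨s, hs0, hsg, hs⟩ := ih _ hlt _ hnn rfl
  refine ⟨s, hs0, ?_, hs⟩
  rw [hsg]
  simp only [sub_smul, mul_smul, Finset.sum_sub_distrib, ← Finset.smul_sum, hcg, smul_zero, sub_zero]

/-- Elements of a finitely generated cone have coefficients bounded by a multiple of their norm. -/
theorem exists_bound_nonneg_combination {ι E : Type*} [Fintype ι] [NormedAddCommGroup E]
    [NormedSpace ℝ E] (g : ι → E) :
    ∃ L : ℝ, ∀ t : ι → ℝ, (∀ i, 0 ≤ t i) → ∃ s : ι → ℝ, (∀ i, 0 ≤ s i) ∧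
      ∑ i, s i • g i = ∑ i, t i • g i ∧ ∀ i, s i ≤ L * ‖∑ i, t i • g i‖ := by
  classical
  have hK : ∀ S : Finset ι, ∃ K : ℝ, 0 ≤ K ∧ (LinearIndepOn ℝ g (S : Set ι) →
      ∀ c : ι → ℝ, (∀ i ∉ S, c i = 0) → ∀ i, c i ≤ K * ‖∑ i, c i • g i‖) := by
    intro S
    by_cases hS : LinearIndepOn ℝ g (S : Set ι)
    swap
    · exact ⟨0, le_rfl, fun h => absurd h hS⟩
    have hinj : LinearMap.ker (Fintype.linearCombination ℝ fun i : S => g i) = ⊥ := by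
      rw [LinearMap.ker_eq_bot]
      exact (linearIndependent_iff_injective_fintypeLinearCombination (v := fun i : S => g i)).1 hS
    obtain ⟨K, -, hK⟩ := LinearMap.exists_antilipschitzWith _ hinj
    refine ⟨K, K.2, fun _ c hc i => ?_⟩
    have hsum : Fintype.linearCombination ℝ (fun i : S => g i) (fun i : S => c i) =
        ∑ i, c i • g i := by
      rw [Fintype.linearCombination_apply, Finset.sum_coe_sort S fun i => c i • g i]
      exact Finset.sum_subset (Finset.subset_univ _) fun i _ hi => by simp [hc i hi]
    have hb := hK.le_mul_norm (map_zero _) (fun i : S => c i)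
    rw [hsum] at hb
    by_cases hi : i ∈ S
    · exact (le_abs_self _).trans ((norm_le_pi_norm (fun i : S => c i) ⟨i, hi⟩).trans hb)
    · rw [hc i hi]; positivity
  choose K hK0 hK using hK
  refine ⟨∑ S, K S, fun t ht => ?_⟩
  obtain ⟨s, hs0, hs, hli⟩ := exists_nonneg_linearIndepOn g t ht
  refine ⟨s, hs0, hs, fun i => ?_⟩
  have h := hK (Finset.univ.filter fun i => s i ≠ 0) (by simpa using hli) s (by simp) i
  rw [hs] at h
  exact h.trans (mul_le_mul_of_nonneg_right
    (Finset.single_le_sum (f := K) (fun S _ => hK0 S) (Finset.mem_univ _)) (norm_nonneg _))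

/-- Finitely generated cones are closed. -/
theorem isClosed_nonneg_combinations {ι E : Type*} [Fintype ι] [NormedAddCommGroup E]
    [NormedSpace ℝ E] (g : ι → E) :
    IsClosed {v : E | ∃ t : ι → ℝ, (∀ i, 0 ≤ t i) ∧ ∑ i, t i • g i = v} := by
  obtain ⟨L, hL⟩ := exists_bound_nonneg_combination g
  refine IsSeqClosed.isClosed fun v a hv hva => ?_
  have h : ∀ m, ∃ s : ι → ℝ, (∀ i, 0 ≤ s i) ∧ ∑ i, s i • g i = v m ∧ ∀ i, s i ≤ L * ‖v m‖ := by
    intro m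
    obtain ⟨t, ht, htv⟩ := hv m
    simpa only [htv] using hL t ht
  choose s hs0 hs hsL using h
  obtain ⟨R, hR⟩ := hva.norm.bddAbove_range
  have hmem : ∀ m, s m ∈ Set.Icc (0 : ι → ℝ) (fun _ => |L| * R) := fun m =>
    ⟨hs0 m, fun i => (hsL m i).trans <|
      mul_le_mul (le_abs_self L) (hR ⟨m, rfl⟩) (norm_nonneg _) (abs_nonneg _)⟩
  obtain ⟨t, ht, ψ, hψ, htend⟩ := isCompact_Icc.tendsto_subseq hmem
  refine ⟨t, ht.1, ?_⟩
  have h1 : Filter.Tendsto (fun m => ∑ i, s (ψ m) i • g i) Filter.atTop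
      (nhds (∑ i, t i • g i)) :=
    tendsto_finsetSum _ fun i _ => ((tendsto_pi_nhds.1 htend) i).smul_const _
  simp only [hs] at h1
  exact tendsto_nhds_unique h1 (hva.comp hψ.tendsto_atTop)

/-- Inhomogeneous Farkas lemma: a finite system of linear inequalities is solvable unless a
nonnegative combination of them is contradictory. -/
theorem exists_forall_inner_le {ι X : Type*} [Fintype ι] [NormedAddCommGroup X]
    [InnerProductSpace ℝ X] [CompleteSpace X] (g : ι → X) (b : ι → ℝ)
    (h : ∀ l : ι → ℝ, (∀ i, 0 ≤ l i) → ∑ i, l i • g i = 0 → 0 ≤ ∑ i, l i * b i) :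
    ∃ u : X, ∀ i, ⟪g i, u⟫ ≤ b i := by
  let G : Option ι → X × ℝ := fun o => o.elim (0, 1) fun i => (g i, b i)
  let K : Set (X × ℝ) := {v | ∃ t : Option ι → ℝ, (∀ i, 0 ≤ t i) ∧ ∑ i, t i • G i = v}
  have hKc : IsClosed K := isClosed_nonneg_combinations G
  have hKconv : Convex ℝ K := by
    rintro _ ⟨s, hs, rfl⟩ _ ⟨t, ht, rfl⟩ α β hα hβ -
    refine ⟨fun i => α * s i + β * t i, fun i => ?_, ?_⟩
    · have := hs i; have := ht i; positivity
    · simp only [add_smul, mul_smul, Finset.sum_add_distrib, Finset.smul_sum]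
  have hK0 : (0 : X × ℝ) ∈ K := ⟨0, fun _ => le_rfl, by simp⟩
  have hsmul : ∀ v ∈ K, ∀ r : ℝ, 0 ≤ r → r • v ∈ K := by
    rintro _ ⟨s, hs, rfl⟩ r hr
    exact ⟨fun i => r * s i, fun i => mul_nonneg hr (hs i), by
      simp only [mul_smul, Finset.smul_sum]⟩
  have hGK : ∀ o, G o ∈ K := by
    classical
    intro o
    refine ⟨Pi.single o 1, fun i => ?_, ?_⟩
    · by_cases hi : i = o
      · subst hi; simp
      · simp [Pi.single_eq_of_ne hi]
    · rw [Finset.sum_eq_single o]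
      · simp
      · intro i _ hi; simp [Pi.single_eq_of_ne hi]
      · simp
  have hnot : ((0 : X), (-1 : ℝ)) ∉ K := by
    rintro ⟨t, ht, hsum⟩
    rw [Fintype.sum_option] at hsum
    have h1 := congrArg Prod.fst hsum
    have h2 := congrArg Prod.snd hsum
    simp only [G, Option.elim, Prod.fst_add, Prod.snd_add, Prod.smul_fst, Prod.smul_snd,
      Prod.fst_sum, Prod.snd_sum, smul_zero, zero_add, smul_eq_mul, mul_one] at h1 h2
    have := h (fun i => t (some i)) (fun i => ht _) h1
    have := ht none
    linarith
  obtain ⟨f, u, hfu, hf⟩ := geometric_hahn_banach_point_closed hKconv hKc hnot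
  have hu : u < 0 := by simpa using hf 0 hK0
  have hpos : ∀ v ∈ K, 0 ≤ f v := by
    intro v hv
    by_contra! hneg
    have := hf _ (hsmul v hv (u / f v) (div_nonneg_of_nonpos hu.le hneg.le))
    rw [map_smul, smul_eq_mul, div_mul_cancel₀ _ hneg.ne] at this
    exact lt_irrefl _ this
  have hs : 0 < f (0, 1) := by
    have : f ((0 : X), (-1 : ℝ)) = -f (0, 1) := by
      rw [← map_neg]; simp
    linarith
  let F : StrongDual ℝ X := f.comp (ContinuousLinearMap.inl ℝ X ℝ)
  refine ⟨-(f (0, 1))⁻¹ • (InnerProductSpace.toDual ℝ X).symm F, fun i => ?_⟩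
  have hi : 0 ≤ f (g i, b i) := hpos _ (hGK (some i))
  have hsplit : f (g i, b i) = F (g i) + b i * f (0, 1) := by
    have : ((g i, b i) : X × ℝ) = (g i, 0) + b i • ((0 : X), (1 : ℝ)) := by simp
    rw [this, map_add, map_smul]; rfl
  rw [inner_smul_right, real_inner_comm, InnerProductSpace.toDual_symm_apply]
  rw [hsplit] at hi
  rw [neg_mul, inv_mul_eq_div, ← neg_div, div_le_iff₀ hs]
  linarith

theorem cycSumH_update_zero {X : Type*} [NormedAddCommGroup X] [InnerProductSpace ℝ X] {p : ℕ}
    (hp : 1 ≤ p) (z : Fin (p + 1) → X × X) (y u : X) :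
    cycSumH p (Function.update z 0 (y, u)) =
      ⟪(z 1).1 - y, u⟫ + cycSumH p (Function.update z 0 (y, 0)) := by
  obtain ⟨q, rfl⟩ : ∃ q, p = q + 1 := ⟨p - 1, by omega⟩
  have hfst : ∀ i, (Function.update z 0 (y, u) i).1 = (Function.update z 0 (y, 0) i).1 := by
    intro i
    by_cases hi : i = 0
    · subst hi; simp
    · simp [Function.update_of_ne hi]
  unfold cycSumH
  rw [Fin.sum_univ_succ, Fin.sum_univ_succ (n := q + 1)
    (f := fun i => ⟪(Function.update z 0 (y, (0 : X)) (i + 1)).1 -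
      (Function.update z 0 (y, (0 : X)) i).1, (Function.update z 0 (y, (0 : X)) i).2⟫)]
  simp only [hfst, Function.update_self, zero_add, inner_zero_right,
    Function.update_of_ne (Fin.succ_ne_zero _)]
  rw [Function.update_of_ne (by simp : (1 : Fin (q + 1 + 1)) ≠ 0)]

theorem cycSumH_update_zero_affine {X : Type*} [NormedAddCommGroup X] [InnerProductSpace ℝ X]
    {p : ℕ} (z : Fin (p + 1) → X × X) :
    ∃ (v : X) (c : ℝ), ∀ y, cycSumH p (Function.update z 0 (y, 0)) = ⟪y, v⟫ + c := by
  have h : ∀ i : Fin (p + 1), ∃ (v : X) (c : ℝ), ∀ y,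
      ⟪(Function.update z 0 (y, (0 : X)) (i + 1)).1 - (Function.update z 0 (y, (0 : X)) i).1,
        (Function.update z 0 (y, (0 : X)) i).2⟫ = ⟪y, v⟫ + c := by
    intro i
    by_cases hi : i = 0
    · subst hi
      exact ⟨0, 0, fun y => by simp⟩
    by_cases hi' : i + 1 = 0
    · exact ⟨(z i).2, -⟪(z i).1, (z i).2⟫, fun y => by
        rw [Function.update_of_ne hi, hi', Function.update_self, inner_sub_left]; ring⟩
    · exact ⟨0, ⟪(z (i + 1)).1 - (z i).1, (z i).2⟫, fun y => by
        rw [Function.update_of_ne hi, Function.update_of_ne hi']; simp⟩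
  choose v c hvc using h
  refine ⟨∑ i, v i, ∑ i, c i, fun y => ?_⟩
  simp only [cycSumH, hvc, Finset.sum_add_distrib, inner_sum]

theorem cycSumH_update_zero_const {X : Type*} [NormedAddCommGroup X] [InnerProductSpace ℝ X]
    {p : ℕ} (hp : 1 ≤ p) (a : X × X) (y u : X) :
    cycSumH p (Function.update (fun _ => a) 0 (y, u)) = ⟪a.1 - y, u⟫ + ⟪y - a.1, a.2⟫ := by
  obtain ⟨q, rfl⟩ : ∃ q, p = q + 1 := ⟨p - 1, by omega⟩
  rw [cycSumH_update_zero hp]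
  congr 1
  unfold cycSumH
  rw [Finset.sum_eq_single (Fin.last (q + 1))]
  · rw [Fin.last_add_one, Function.update_self, Function.update_of_ne (Fin.last_pos.ne')]
  · intro i _ hi
    by_cases h0 : i = 0
    · subst h0; simp
    have h1 : i + 1 ≠ 0 := by
      intro h
      apply hi
      have := eq_neg_of_add_eq_zero_left h
      rw [this, eq_comm]
      exact eq_neg_of_add_eq_zero_left (Fin.last_add_one _)
    simp [Function.update_of_ne h0, Function.update_of_ne h1]
  · simp

/-- Membership in the polar as a family of inequalities affine in the dual variable. -/
theorem mem_cycPolarH_iff {X : Type*} [NormedAddCommGroup X] [InnerProductSpace ℝ X]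
    {p : ℕ} (hp : 1 ≤ p) (T : Set (X × X)) (y u : X) :
    (y, u) ∈ cycPolarH p T ↔ ∀ z : Fin (p + 1) → X × X, (∀ i, i ≠ 0 → z i ∈ T) →
      ⟪(z 1).1 - y, u⟫ + cycSumH p (Function.update z 0 (y, 0)) ≤ 0 := by
  constructor
  · intro h z hz
    rw [← cycSumH_update_zero hp]
    refine h _ (Function.update_self ..) fun i hi => ?_
    rw [Function.update_of_ne hi]
    exact hz i hi
  · intro h z hz0 hz
    have := h z hz
    rwa [← cycSumH_update_zero hp, ← hz0, Function.update_eq_self] at this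

/-- Splitting a cycle along a set of indices that is entered and left only at the base point of `a`,
filling up with copies of `a`. -/
theorem cycSumH_split {X : Type*} [NormedAddCommGroup X] [InnerProductSpace ℝ X] {p : ℕ}
    (z : Fin (p + 1) → X × X) (a : X × X) (A : Fin (p + 1) → Prop) [DecidablePred A]
    (hA : ∀ i, ¬(A i ↔ A (i + 1)) → (z (i + 1)).1 = a.1) :
    cycSumH p z =
      cycSumH p (fun i => if A i then z i else a) + cycSumH p (fun i => if A i then a else z i) := by
  unfold cycSumH
  rw [← Finset.sum_add_distrib]
  refine Finset.sum_congr rfl fun i _ => ?_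
  have := hA i
  by_cases h1 : A i <;> by_cases h2 : A (i + 1) <;> simp_all

theorem cycSumH_rotate {X : Type*} [NormedAddCommGroup X] [InnerProductSpace ℝ X] {p : ℕ}
    (z : Fin (p + 1) → X × X) (j : Fin (p + 1)) :
    cycSumH p (fun i => z (i + j)) = cycSumH p z := by
  unfold cycSumH
  rw [← Equiv.sum_comp (Equiv.addRight j) fun i => ⟪(z (i + 1)).1 - (z i).1, (z i).2⟫]
  refine Finset.sum_congr rfl fun i _ => ?_
  simp only [Equiv.coe_addRight, add_right_comm]

/-- Enlarging the image at a point of the domain by the polar preserves cyclic monotonicity. -/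
theorem CycMonoH.union_polar_fiber {X : Type*} [NormedAddCommGroup X] [InnerProductSpace ℝ X]
    {p : ℕ} {T : Set (X × X)} (hT : CycMonoH p T) {a : X × X} (ha : a ∈ T) :
    CycMonoH p (({a.1} ×ˢ opIm (cycPolarH p T) a.1) ∪ T) := by
  classical
  intro z hz
  induction hm : (Finset.univ.filter fun i => z i ∉ T).card using Nat.strong_induction_on
    generalizing z with
  | _ m ih =>
  have hbase : ∀ i, z i ∉ T → (z i).1 = a.1 ∧ z i ∈ cycPolarH p T := by
    intro i hi
    rcases hz i with h | h
    · obtain ⟨h1, h2⟩ := h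
      have h1 : (z i).1 = a.1 := h1
      refine ⟨h1, ?_⟩
      have h2 : (a.1, (z i).2) ∈ cycPolarH p T := h2
      rwa [← h1] at h2
    · exact absurd h hi
  by_cases h0 : ∀ i, z i ∈ T
  · exact hT z h0
  push Not at h0
  by_cases h1 : ∀ i j, i < j → z i ∉ T → z j ∈ T
  · obtain ⟨j, hj⟩ := h0
    rw [← cycSumH_rotate z j]
    refine (hbase j hj).2 _ (by simp) fun i hi => ?_
    by_contra hij
    have hne : i + j ≠ j := by simpa using hi
    rcases lt_or_gt_of_ne hne with h | h
    · exact hj (h1 _ _ h hij)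
    · exact hij (h1 _ _ h hj)
  push Not at h1
  obtain ⟨i, j, hij, hi, hj⟩ := h1
  have hsplit := cycSumH_split z a (fun t => i ≤ t ∧ t < j) ?_
  · rw [hsplit]
    have hU : ∀ (A : Fin (p + 1) → Prop) [DecidablePred A], (∃ k, ¬ A k ∧ z k ∉ T) →
        cycSumH p (fun t => if A t then z t else a) ≤ 0 := by
      intro A _ ⟨k, hkA, hk⟩
      refine ih _ ?_ _ (fun t => ?_) rfl
      · rw [← hm]
        refine Finset.card_lt_card (Finset.ssubset_iff_of_subset ?_ |>.2 ⟨k, by simpa using hk, ?_⟩)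
        · intro t
          by_cases h : A t <;> simp [h, ha]
        · simp [hkA, ha]
      · by_cases h : A t
        · simpa only [h, if_true] using hz t
        · simp only [h, if_false]
          exact Or.inr ha
    have e1 := hU (fun t => i ≤ t ∧ t < j) ⟨j, by simp, hj⟩
    have e2 := hU (fun t => ¬ (i ≤ t ∧ t < j)) ⟨i, by simp [hij], hi⟩
    simp only [ite_not] at e2
    linarith
  · intro t ht
    by_cases hlast : t = Fin.last p
    · subst hlast
      rw [Fin.last_add_one] at ht ⊢
      have : (0 : Fin (p + 1)) = i := by
        have := Fin.le_last j
        simp only [Fin.le_def, Fin.lt_def, Fin.ext_iff, Fin.val_zero, Fin.val_last] at *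
        omega
      rw [this]
      exact (hbase i hi).1
    · have hv : (t + 1).val = t.val + 1 := by
        rw [Fin.val_add_one, if_neg hlast]
      have : t + 1 = i ∨ t + 1 = j := by
        simp only [Fin.le_def, Fin.lt_def, Fin.ext_iff, hv] at *
        omega
      rcases this with h | h <;> rw [h]
      · exact (hbase i hi).1
      · exact (hbase j hj).1

theorem exists_convexHull_range {ι E : Type*} [Fintype ι] [AddCommGroup E] [Module ℝ E]
    (x : ι → E) {y : E} (hy : y ∈ convexHull ℝ (Set.range x)) :
    ∃ t : ι → ℝ, (∀ i, 0 ≤ t i) ∧ ∑ i, t i = 1 ∧ ∑ i, t i • x i = y := by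
  classical
  refine convexHull_min (t := {y | ∃ t : ι → ℝ, (∀ i, 0 ≤ t i) ∧ ∑ i, t i = 1 ∧
    ∑ i, t i • x i = y}) ?_ ?_ hy
  · rintro _ ⟨i, rfl⟩
    exact ⟨Pi.single i 1, fun j => by by_cases h : j = i <;> simp [h],
      by simp, by simp [Pi.single_apply, ite_smul]⟩
  · rintro _ ⟨s, hs0, hs1, rfl⟩ _ ⟨t, ht0, ht1, rfl⟩ α β hα hβ hαβ
    refine ⟨fun i => α * s i + β * t i, fun i => ?_, ?_, ?_⟩
    · have := hs0 i; have := ht0 i; positivity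
    · simp only [Finset.sum_add_distrib, ← Finset.mul_sum, hs1, ht1, mul_one, hαβ]
    · simp only [add_smul, mul_smul, Finset.sum_add_distrib, Finset.smul_sum]

/-- Openness of the convex-combination map: a nonnegative weight with barycentre `y` is a limit of
nonnegative weights with barycentres `y' m`, for any sequence `y' m → y` in the convex hull. -/
theorem exists_weights_tendsto {ι E : Type*} [Fintype ι] [NormedAddCommGroup E]
    [NormedSpace ℝ E] (x : ι → E) {y : E} {y' : ℕ → E}
    (hy' : ∀ m, y' m ∈ convexHull ℝ (Set.range x))
    (hlim : Filter.Tendsto y' Filter.atTop (nhds y)) {l : ι → ℝ} (hl : ∀ i, 0 ≤ l i)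
    (hly : ∑ i, l i • (x i - y) = 0) :
    ∃ r : ℕ → ι → ℝ, (∀ᶠ m in Filter.atTop, ∀ i, 0 ≤ r m i) ∧
      (∀ m, ∑ i, r m i • (x i - y' m) = 0) ∧
      ∀ i, Filter.Tendsto (fun m => r m i) Filter.atTop (nhds (l i)) := by
  obtain ⟨L, hL⟩ := exists_bound_nonneg_combination fun i => x i - y
  have h : ∀ m, ∃ s : ι → ℝ, (∀ i, 0 ≤ s i) ∧ ∑ i, s i • (x i - y) = y' m - y ∧
      ∀ i, s i ≤ L * ‖y' m - y‖ := by
    intro m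
    obtain ⟨t, ht0, ht1, ht⟩ := exists_convexHull_range x (hy' m)
    have hty : ∑ i, t i • (x i - y) = y' m - y := by
      simp only [smul_sub, Finset.sum_sub_distrib, ← Finset.sum_smul, ht1, ht, one_smul]
    simpa only [hty] using hL t ht0
  choose s hs0 hs hsL using h
  have hs_tend : ∀ i, Filter.Tendsto (fun m => s m i) Filter.atTop (nhds 0) := by
    intro i
    refine squeeze_zero (fun m => hs0 m i) (fun m => hsL m i) ?_
    have := (tendsto_iff_norm_sub_tendsto_zero.1 hlim).const_mul L
    simpa using this
  have hsum_tend : Filter.Tendsto (fun m => ∑ i, s m i) Filter.atTop (nhds 0) := by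
    simpa using tendsto_finsetSum Finset.univ fun i _ => hs_tend i
  refine ⟨fun m i => (1 - ∑ j, s m j) * l i + (∑ j, l j) * s m i, ?_, fun m => ?_, fun i => ?_⟩
  · filter_upwards [hsum_tend.eventually_le_const zero_lt_one] with m hm i
    have h1 := hl i
    have h2 := hs0 m i
    have h3 : 0 ≤ ∑ j, l j := Finset.sum_nonneg fun j _ => hl j
    have h4 : 0 ≤ 1 - ∑ j, s m j := by linarith
    positivity
  · have hsplit : ∀ i, x i - y' m = (x i - y) - (y' m - y) := fun i => by abel
    simp only [hsplit, smul_sub _ (_ - y) (_ - y), Finset.sum_sub_distrib, ← Finset.sum_smul]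
    simp only [add_smul, mul_smul, Finset.sum_add_distrib, ← Finset.smul_sum, ← Finset.mul_sum,
      hly, hs m]
    module
  · simpa using ((hsum_tend.const_sub 1).mul_const (l i)).add ((hs_tend i).const_mul (∑ j, l j))

/-- The set of parameters for which a system of inequalities indexed by finitely many slopes
`x i - y` is solvable is closed, provided it contains the points `x i` and lies in their
convex hull. -/
theorem isClosed_setOf_exists_inner_le {ι X : Type*} [Fintype ι] [NormedAddCommGroup X]
    [InnerProductSpace ℝ X] [CompleteSpace X] (x : ι → X) {κ : ι → Type*} [∀ i, Nonempty (κ i)]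
    (v : ∀ i, κ i → X) (c : ∀ i, κ i → ℝ)
    (hx : ∀ j, ∃ u, ∀ i k, ⟪x i - x j, u⟫ + (⟪x j, v i k⟫ + c i k) ≤ 0)
    (hD : {y | ∃ u, ∀ i k, ⟪x i - y, u⟫ + (⟪y, v i k⟫ + c i k) ≤ 0} ⊆
      convexHull ℝ (Set.range x)) :
    IsClosed {y | ∃ u, ∀ i k, ⟪x i - y, u⟫ + (⟪y, v i k⟫ + c i k) ≤ 0} := by
  refine IsSeqClosed.isClosed fun y' y hy' hlim => ?_
  have hC : IsClosed (convexHull ℝ (Set.range x)) :=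
    (Set.finite_range x).isClosed_convexHull ℝ
  have hyC : y ∈ convexHull ℝ (Set.range x) :=
    hC.mem_of_tendsto hlim (Filter.Eventually.of_forall fun m => hD (hy' m))
  choose u' hu' using hy'
  choose U hU using hx
  have hbdd : ∀ i, BddAbove (Set.range fun k => ⟪y, v i k⟫ + c i k) := by
    intro i
    refine ⟨∑ j, |⟪x i - x j, U j⟫|, ?_⟩
    rintro _ ⟨k, rfl⟩
    have hconv : Convex ℝ {y : X | ⟪y, v i k⟫ ≤ ∑ j, |⟪x i - x j, U j⟫| - c i k} := by
      refine convex_halfSpace_le ⟨fun a b => inner_add_left a b _, fun r a => ?_⟩ _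
      simp [inner_smul_left]
    have hsub := convexHull_min ?_ hconv hyC
    · simp only [Set.mem_ofPred_eq] at hsub
      linarith
    · rintro _ ⟨j, rfl⟩
      have h1 := hU j i k
      have h2 := Finset.single_le_sum (f := fun j => |⟪x i - x j, U j⟫|)
        (fun j _ => abs_nonneg _) (Finset.mem_univ j)
      have h3 := neg_abs_le ⟪x i - x j, U j⟫
      simp only [Set.mem_ofPred_eq]
      linarith
  suffices h : ∀ l : ι → ℝ, (∀ i, 0 ≤ l i) → ∑ i, l i • (x i - y) = 0 →
      0 ≤ ∑ i, l i * -⨆ k, (⟪y, v i k⟫ + c i k) by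
    obtain ⟨u, hu⟩ := exists_forall_inner_le (fun i => x i - y)
      (fun i => -⨆ k, (⟪y, v i k⟫ + c i k)) h
    refine ⟨u, fun i k => ?_⟩
    have := le_ciSup (hbdd i) k
    have := hu i
    linarith
  intro l hl hly
  have hsel : ∀ k : ∀ i, κ i, ∑ i, l i * (⟪y, v i (k i)⟫ + c i (k i)) ≤ 0 := by
    intro k
    obtain ⟨r, hr0, hr, hrl⟩ := exists_weights_tendsto x (fun m => hD ⟨_, hu' m⟩) hlim hl hly
    have htend : Filter.Tendsto (fun m => ∑ i, r m i * (⟪y' m, v i (k i)⟫ + c i (k i)))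
        Filter.atTop (nhds (∑ i, l i * (⟪y, v i (k i)⟫ + c i (k i)))) :=
      tendsto_finsetSum _ fun i _ => (hrl i).mul ((hlim.inner tendsto_const_nhds).add_const _)
    refine le_of_tendsto htend ?_
    filter_upwards [hr0] with m hm
    have h1 : ∑ i, r m i * ⟪x i - y' m, u' m⟫ = 0 := by
      rw [← inner_zero_left (𝕜 := ℝ) (u' m), ← hr m, sum_inner]
      simp [inner_smul_left]
    have h2 : ∑ i, r m i * (⟪x i - y' m, u' m⟫ + (⟪y' m, v i (k i)⟫ + c i (k i))) ≤ 0 :=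
      Finset.sum_nonpos fun i _ => mul_nonpos_of_nonneg_of_nonpos (hm i) (hu' m i (k i))
    simp only [mul_add (r m _) ⟪x _ - y' m, u' m⟫, Finset.sum_add_distrib, h1, zero_add] at h2
    exact h2
  have hgoal : ∑ i, l i * (⨆ k, (⟪y, v i k⟫ + c i k)) ≤ 0 := by
    have hε : ∀ ε > 0, ∑ i, l i * (⨆ k, (⟪y, v i k⟫ + c i k)) ≤ ε * ∑ i, l i := by
      intro ε hε
      have hex : ∀ i, ∃ k, (⨆ k, (⟪y, v i k⟫ + c i k)) - ε < ⟪y, v i k⟫ + c i k := fun i =>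
        exists_lt_of_lt_ciSup (sub_lt_self _ hε)
      choose k hk using hex
      have : ∑ i, l i * ((⨆ k, (⟪y, v i k⟫ + c i k)) - ε) ≤ 0 :=
        (Finset.sum_le_sum fun i _ => mul_le_mul_of_nonneg_left (hk i).le (hl i)).trans (hsel k)
      simp only [mul_sub, Finset.sum_sub_distrib, ← Finset.sum_mul] at this
      linarith
    have htend : Filter.Tendsto (fun ε : ℝ => ε * ∑ i, l i) (nhdsWithin 0 (Set.Ioi 0)) (nhds 0) := by
      have : Continuous fun ε : ℝ => ε * ∑ i, l i := by fun_prop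
      simpa using (this.tendsto 0).mono_left nhdsWithin_le_nhds
    exact ge_of_tendsto htend (Filter.eventually_of_mem self_mem_nhdsWithin hε)
  simp only [mul_neg, Finset.sum_neg_distrib]
  linarith

theorem cycPolarH_dom_subset_convexHull {X : Type*} [NormedAddCommGroup X]
    [InnerProductSpace ℝ X] [CompleteSpace X] {ι : Type*} [Finite ι] [Nonempty ι] {p : ℕ}
    (hp : 1 ≤ p) {T : Set (X × X)} (w : ι → X × X)
    (hT : ∀ i d, (∀ j, ⟪(w j).1 - (w i).1, d⟫ ≤ 0) → ((w i).1, (w i).2 + d) ∈ T) :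
    opDom (cycPolarH p T) ⊆ convexHull ℝ (Set.range fun i => (w i).1) := by
  rintro y ⟨u, hu⟩
  by_contra hy
  obtain ⟨f, r, hfr, hry⟩ := geometric_hahn_banach_closed_point (convex_convexHull ℝ _)
    ((Set.finite_range fun i => (w i).1).isClosed_convexHull ℝ) hy
  obtain ⟨i, hi⟩ := Finite.exists_max fun i => f (w i).1
  let d := (InnerProductSpace.toDual ℝ X).symm f
  have hd : ∀ a, ⟪a, d⟫ = f a := fun a => by
    rw [real_inner_comm, InnerProductSpace.toDual_symm_apply]
  have hpos : 0 < f (y - (w i).1) := by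
    rw [map_sub, sub_pos]
    exact (hfr _ (subset_convexHull ℝ _ ⟨i, rfl⟩)).trans hry
  have hall : ∀ s : ℝ, 0 ≤ s →
      ⟪(w i).1 - y, u⟫ + ⟪y - (w i).1, (w i).2⟫ + s * f (y - (w i).1) ≤ 0 := by
    intro s hs
    have hmem := hT i (s • d) fun j => by
      rw [inner_smul_right, hd, map_sub]
      exact mul_nonpos_of_nonneg_of_nonpos hs (sub_nonpos.2 (hi j))
    have h := hu (Function.update (fun _ => ((w i).1, (w i).2 + s • d)) 0 (y, u))
      (Function.update_self ..) fun j hj => by rwa [Function.update_of_ne hj]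
    rw [cycSumH_update_zero_const hp, inner_add_right, inner_smul_right, hd] at h
    linarith
  set c := ⟪(w i).1 - y, u⟫ + ⟪y - (w i).1, (w i).2⟫
  have h := hall ((|c| + 1) / f (y - (w i).1)) (by positivity)
  rw [div_mul_cancel₀ _ hpos.ne'] at h
  linarith [neg_abs_le c]

theorem cycPolarH_dom_isClosed {X : Type*} [NormedAddCommGroup X]
    [InnerProductSpace ℝ X] [CompleteSpace X] {ι : Type*} [Fintype ι] {p : ℕ}
    (hp : 1 ≤ p) {T : Set (X × X)} (hT : CycMonoH p T) (w : ι → X × X) (hw : ∀ i, w i ∈ T)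
    (hfst : ∀ a ∈ T, ∃ i, (w i).1 = a.1)
    (hdom : opDom (cycPolarH p T) ⊆ convexHull ℝ (Set.range fun i => (w i).1)) :
    IsClosed (opDom (cycPolarH p T)) := by
  let κ : ι → Type _ := fun i =>
    {z : Fin (p + 1) → X × X // (∀ j, j ≠ 0 → z j ∈ T) ∧ (z 1).1 = (w i).1}
  have : ∀ i, Nonempty (κ i) := fun i => ⟨⟨fun _ => w i, fun _ _ => hw i, rfl⟩⟩
  choose v c hvc using fun z : Fin (p + 1) → X × X => cycSumH_update_zero_affine z
  have h1 : (1 : Fin (p + 1)) ≠ 0 := by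
    obtain ⟨q, rfl⟩ : ∃ q, p = q + 1 := ⟨p - 1, by omega⟩
    simp
  have hmem : ∀ y u, (y, u) ∈ cycPolarH p T ↔
      ∀ i (k : κ i), ⟪(w i).1 - y, u⟫ + (⟪y, v k.1⟫ + c k.1) ≤ 0 := by
    intro y u
    rw [mem_cycPolarH_iff hp]
    constructor
    · intro h i k
      have hk := h _ k.2.1
      rwa [hvc, k.2.2] at hk
    · intro h z hz
      obtain ⟨i, hi⟩ := hfst _ (hz 1 h1)
      rw [hvc, ← hi]
      exact h i ⟨z, hz, hi.symm⟩
  have hD : opDom (cycPolarH p T) =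
      {y | ∃ u, ∀ i (k : κ i), ⟪(w i).1 - y, u⟫ + (⟪y, v k.1⟫ + c k.1) ≤ 0} := by
    ext y
    exact exists_congr fun u => hmem y u
  rw [hD] at hdom ⊢
  refine isClosed_setOf_exists_inner_le (fun i => (w i).1) (κ := κ) (fun _ k => v k.1)
    (fun _ k => c k.1)
    (fun j => ⟨(w j).2, (hmem _ _).1 fun z hz0 hz => hT z fun i => ?_⟩) hdom
  by_cases hi : i = 0
  · rw [hi, hz0]; exact hw j
  · exact hz i hi

theorem construction_dom_closed {X : Type*} [NormedAddCommGroup X] [InnerProductSpace ℝ X]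
    [FiniteDimensional ℝ X]
    (p n : ℕ) (hp : 2 ≤ p) (w : Fin n → X × X) (T : ℕ → Set (X × X))
    (hmono : CycMonoH p (Set.range w))
    (hT0 : T 0 = Set.range w)
    (hTk : ∀ k : Fin n, T ((k : ℕ) + 1) =
      ({(w k).1} ×ˢ opIm (cycPolarH p (T (k : ℕ))) (w k).1) ∪ T (k : ℕ))
    (hTn1 : T (n + 1) = cycPolarH p (T n)) :
    IsClosed (opDom (T (n + 1))) := by
  have hp1 : 1 ≤ p := by omega
  have hone : (1 : Fin (p + 1)) ≠ 0 := by
    obtain ⟨q, rfl⟩ : ∃ q, p = q + 1 := ⟨p - 1, by omega⟩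
    simp
  have : CompleteSpace X := FiniteDimensional.complete ℝ X
  have hstep : ∀ k (hk : k < n), T (k + 1) =
      ({(w ⟨k, hk⟩).1} ×ˢ opIm (cycPolarH p (T k)) (w ⟨k, hk⟩).1) ∪ T k :=
    fun k hk => hTk ⟨k, hk⟩
  have hinv : ∀ k ≤ n, CycMonoH p (T k) ∧ (∀ i, w i ∈ T k) ∧ ∀ a ∈ T k, ∃ i, (w i).1 = a.1 := by
    intro k
    induction k with
    | zero =>
      intro _
      rw [hT0]
      refine ⟨hmono, fun i => ⟨i, rfl⟩, ?_⟩
      rintro _ ⟨i, rfl⟩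
      exact ⟨i, rfl⟩
    | succ k ih =>
      intro hk
      obtain ⟨h1, h2, h3⟩ := ih (by omega)
      rw [hstep k hk]
      refine ⟨h1.union_polar_fiber (h2 _), fun i => Or.inr (h2 i), ?_⟩
      rintro a (ha | ha)
      · exact ⟨⟨k, hk⟩, ha.1.symm⟩
      · exact h3 a ha
  have hsub : ∀ k ≤ n, T k ⊆ T n := by
    intro k hk
    induction hk using Nat.decreasingInduction with
    | self => exact subset_rfl
    | of_succ k hk ih =>
      refine subset_trans ?_ ih
      rw [hstep k hk]
      exact Set.subset_union_right
  obtain ⟨hmon, hw, hfst⟩ := hinv n le_rfl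
  rw [hTn1]
  rcases isEmpty_or_nonempty (Fin n) with hn | hn
  · have huniv : opDom (cycPolarH p (T n)) = Set.univ := by
      refine Set.eq_univ_of_forall fun y => ⟨0, fun z _ hz => ?_⟩
      obtain ⟨i, -⟩ := hfst _ (hz 1 hone)
      exact hn.elim i
    rw [huniv]
    exact isClosed_univ
  refine cycPolarH_dom_isClosed hp1 hmon w hw hfst
    (cycPolarH_dom_subset_convexHull hp1 w fun i d hd => ?_)
  apply hsub (i + 1) i.2
  rw [hTk i]
  obtain ⟨hmon', hw', hfst'⟩ := hinv i i.2.le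
  refine Or.inl ⟨rfl, ?_⟩
  refine (mem_cycPolarH_iff hp1 _ _ _).2 fun z hz => ?_
  have hwi : ((w i).1, (w i).2) ∈ cycPolarH p (T i) := fun z hz0 hz => hmon' z fun t => by
    by_cases ht : t = 0
    · rw [ht, hz0]; exact hw' i
    · exact hz t ht
  have h1 := (mem_cycPolarH_iff hp1 _ _ _).1 hwi z hz
  obtain ⟨j, hj⟩ := hfst' _ (hz 1 hone)
  have h2 := hd j
  rw [hj] at h2
  rw [inner_add_right]
  linarith
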